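/- Let N, L be positive integers, Δ > 0 a real number, Λ = diag(λ_1, …, λ_N) a diagonal matrix with all λ_i ≠ 0 and exp(L·λ_i·Δ) ≠ 1 for every i, and w ∈ ℂ^N a row vector. Let B' ∈ ℂ^N be the column vector with entries B'_i = (exp(L·λ_i·Δ) − 1)^{−1}. Then for every 0 ≤ k < L, K̄_{Δ,L}(Λ, B', w)_k = Σ_{i=1}^{N} (w_i / λ_i) · exp(λ_i·k·Δ) / (Σ_{r=0}^{L−1} exp(λ_i·r·Δ)); in particular the inner denominators Σ_{r=0}^{L−1} exp(λ_i·r·Δ) are nonzero. -/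

import Mathlib

open Matrix NormedSpace Finset

/-- The SSM kernel `K̄_{Δ,L}(A,B,C)_k = C · exp(kΔA) · (exp(ΔA) − I) · A⁻¹ · B`,
as a function of the position `k` (positions `0 ≤ k < L` are the entries of the kernel). -/
noncomputable def ssmKernel {N : ℕ} (Δ : ℝ) (A : Matrix (Fin N) (Fin N) ℂ)
    (B C : Fin N → ℂ) (k : ℕ) : ℂ :=
  C ⬝ᵥ ((exp (((k : ℂ) * (Δ : ℂ)) • A) * (exp ((Δ : ℂ) • A) - 1) * A⁻¹) *ᵥ B)

lemma exp_smul_diagonal {N : ℕ} (c : ℂ) (lam : Fin N → ℂ) :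
    exp (c • Matrix.diagonal lam) = Matrix.diagonal fun i => Complex.exp (c * lam i) := by
  rw [← Matrix.diagonal_smul, Matrix.exp_diagonal]
  congr 1
  ext i
  rw [Pi.coe_exp, Complex.exp_eq_exp_ℂ]
  rfl

lemma inv_diagonal_of_ne_zero {N : ℕ} {lam : Fin N → ℂ} (hlam : ∀ i, lam i ≠ 0) :
    (Matrix.diagonal lam)⁻¹ = Matrix.diagonal fun i => (lam i)⁻¹ := by
  refine Matrix.inv_eq_right_inv ?_
  simp [Matrix.diagonal_mul_diagonal, hlam]

lemma ssmKernel_diagonal {N : ℕ} (Δ : ℝ) {lam : Fin N → ℂ} (hlam : ∀ i, lam i ≠ 0)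
    (B C : Fin N → ℂ) (k : ℕ) :
    ssmKernel Δ (Matrix.diagonal lam) B C k =
      ∑ i, C i * (Complex.exp (k * Δ * lam i) * (Complex.exp (Δ * lam i) - 1) *
        (lam i)⁻¹ * B i) := by
  rw [ssmKernel, exp_smul_diagonal, exp_smul_diagonal, inv_diagonal_of_ne_zero hlam,
    ← Matrix.diagonal_one, Matrix.diagonal_sub, Matrix.diagonal_mul_diagonal,
    Matrix.diagonal_mul_diagonal]
  simp only [dotProduct, Matrix.mulVec_diagonal]

lemma sum_range_exp_mul_sub_one (z t : ℂ) (L : ℕ) :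
    (∑ r ∈ Finset.range L, Complex.exp (z * r * t)) * (Complex.exp (t * z) - 1) =
      Complex.exp (L * z * t) - 1 := by
  have h (r : ℕ) : Complex.exp (z * r * t) = Complex.exp (t * z) ^ r := by
    rw [← Complex.exp_nat_mul]
    congr 1
    ring
  simp_rw [h]
  rw [geom_sum_mul, ← h]
  congr 2
  ring

theorem diag_kernel_softmax_formula {N L : ℕ} (hN : 0 < N) (hL : 0 < L) (Δ : ℝ) (hΔ : 0 < Δ)
    (lam : Fin N → ℂ) (hlam : ∀ i, lam i ≠ 0)
    (hexp : ∀ i, Complex.exp ((L : ℂ) * lam i * (Δ : ℂ)) ≠ 1)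
    (w : Fin N → ℂ) :
    (∀ i, ∑ r ∈ Finset.range L, Complex.exp (lam i * (r : ℂ) * (Δ : ℂ)) ≠ 0) ∧
    ∀ k < L, ssmKernel Δ (Matrix.diagonal lam)
        (fun i => (Complex.exp ((L : ℂ) * lam i * (Δ : ℂ)) - 1)⁻¹) w k =
      ∑ i : Fin N, (w i / lam i) * Complex.exp (lam i * (k : ℂ) * (Δ : ℂ)) /
        (∑ r ∈ Finset.range L, Complex.exp (lam i * (r : ℂ) * (Δ : ℂ))) := by
  have hgeom i := sum_range_exp_mul_sub_one (lam i) Δ L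
  have hne i := sub_ne_zero.mpr (hexp i)
  have hsum i : ∑ r ∈ Finset.range L, Complex.exp (lam i * (r : ℂ) * (Δ : ℂ)) ≠ 0 :=
    left_ne_zero_of_mul (hgeom i ▸ hne i)
  refine ⟨hsum, fun k _ => ?_⟩
  rw [ssmKernel_diagonal Δ hlam]
  refine Finset.sum_congr rfl fun i _ => ?_
  have hfactor : Complex.exp (Δ * lam i) - 1 ≠ 0 := right_ne_zero_of_mul (hgeom i ▸ hne i)
  have hk : (k : ℂ) * Δ * lam i = lam i * k * Δ := by ring
  rw [← hgeom i, hk, mul_inv, div_eq_mul_inv, div_eq_mul_inv]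
  linear_combination w i * Complex.exp (lam i * k * Δ) * (lam i)⁻¹ *
    (∑ r ∈ Finset.range L, Complex.exp (lam i * (r : ℂ) * (Δ : ℂ)))⁻¹ * mul_inv_cancel₀ hfactor
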